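/- Let (S,T) be a valid pair of spanning 2-matchings of G and suppose S contains a cycle C. Then C contains two distinct edges e1 and e2 such that, writing S_i = S \ {e_i} and T_i = T ∪ {e_i} for i = 1,2, the following hold: (a) (S_i, T_i) is a valid pair of spanning 2-matchings for i = 1,2; (b) V1(S_i) ∪ V1(T_i) = V1(S) ∪ V1(T) and V1(S_i) ∩ V1(T_i) = V1(S) ∩ V1(T) for i = 1,2; and (c) 𝒫(T) contains a path P such that both P ∪ {e1} and P ∪ {e2} are paths. -/

import Mathlib

variable {V : Type*} [Fintype V] [DecidableEq V]

/-- The degree of vertex `v` in the edge set `F`. -/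
def degE (F : Finset (Sym2 V)) (v : V) : ℕ := (F.filter (fun e => v ∈ e)).card

/-- The set of vertices incident to an edge of `F`. -/
def VsetE (F : Finset (Sym2 V)) : Set V := {v | ∃ e ∈ F, v ∈ e}

/-- Vertices incident to exactly one edge of `F`. -/
def V1E (F : Finset (Sym2 V)) : Set V := {v | degE F v = 1}

/-- Vertices incident to exactly two edges of `F`. -/
def V2E (F : Finset (Sym2 V)) : Set V := {v | degE F v = 2}

/-- All edges are genuine edges of the complete graph (no loops). -/
def SimpleE (F : Finset (Sym2 V)) : Prop := ∀ e ∈ F, ¬ e.IsDiag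

/-- `F` is spanning: every vertex is incident to an edge of `F`. -/
def SpanningE (F : Finset (Sym2 V)) : Prop := VsetE F = Set.univ

/-- `F` is a `k`-matching: every vertex has at most `k` incident edges. -/
def IsKMatching (k : ℕ) (F : Finset (Sym2 V)) : Prop :=
  SimpleE F ∧ ∀ v : V, degE F v ≤ k

/-- `F` is a `k`-factor: every vertex has exactly `k` incident edges. -/
def IsKFactor (k : ℕ) (F : Finset (Sym2 V)) : Prop :=
  SimpleE F ∧ ∀ v : V, degE F v = k

/-- `F` is the edge set of a single (simple) cycle. -/
def IsCycleE (F : Finset (Sym2 V)) : Prop :=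
  ∃ m : ℕ, 3 ≤ m ∧ ∃ f : ℕ → V,
    (∀ i < m, ∀ j < m, f i = f j → i = j) ∧
    F = (Finset.range m).image (fun i => s(f i, f ((i + 1) % m)))

/-- `F` contains no cycle. -/
def AcyclicE (F : Finset (Sym2 V)) : Prop :=
  ∀ C : Finset (Sym2 V), C ⊆ F → ¬ IsCycleE C

/-- `F` is the edge set of a simple path with endpoints `a` and `b`. -/
def IsPathE (F : Finset (Sym2 V)) (a b : V) : Prop :=
  ∃ m : ℕ, 1 ≤ m ∧ ∃ f : ℕ → V,
    (∀ i ≤ m, ∀ j ≤ m, f i = f j → i = j) ∧ f 0 = a ∧ f m = b ∧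
    F = (Finset.range m).image (fun i => s(f i, f (i + 1)))

/-- `P` is a maximal path of `F`, i.e. `P ∈ 𝒫(F)`. -/
def MaxPathE (F P : Finset (Sym2 V)) : Prop :=
  P ⊆ F ∧ (∃ a b : V, IsPathE P a b) ∧
  ∀ e ∈ F, (∃ v : V, v ∈ e ∧ v ∈ VsetE P) → e ∈ P

/-- `F` is a path cover: a spanning acyclic 2-matching. -/
def IsPathCoverE (F : Finset (Sym2 V)) : Prop :=
  IsKMatching 2 F ∧ SpanningE F ∧ AcyclicE F

/-- `F` is a tour: the edge set of a Hamiltonian cycle. -/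
def IsTourE (F : Finset (Sym2 V)) : Prop :=
  IsCycleE F ∧ SpanningE F

/-- Total length of the edge set `F`. -/
def lenE (ℓ : Sym2 V → ℝ) (F : Finset (Sym2 V)) : ℝ := ∑ e ∈ F, ℓ e

/-- Minimum length of a tour. -/
noncomputable def optE (ℓ : Sym2 V → ℝ) : ℝ :=
  sInf {x | ∃ H : Finset (Sym2 V), IsTourE H ∧ lenE ℓ H = x}

/-- Maximum length of a tour. -/
noncomputable def worE (ℓ : Sym2 V → ℝ) : ℝ :=
  sSup {x | ∃ H : Finset (Sym2 V), IsTourE H ∧ lenE ℓ H = x}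

/-- The set of edges of `F` incident to `v`. -/
def deltaE (F : Finset (Sym2 V)) (v : V) : Finset (Sym2 V) :=
  F.filter (fun e => v ∈ e)

/-- `(S, T)` is a valid pair of spanning 2-matchings. -/
def ValidPairE (S T : Finset (Sym2 V)) : Prop :=
  IsKMatching 2 S ∧ IsKMatching 2 T ∧ SpanningE S ∧ SpanningE T ∧
  AcyclicE T ∧
  (∀ v : V, v ∈ V2E S → v ∈ V2E T → deltaE S v = deltaE T v) ∧
  (∀ C : Finset (Sym2 V), C ⊆ S → IsCycleE C →
    ∀ P : Finset (Sym2 V), MaxPathE T P → VsetE C ≠ VsetE P)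

set_option linter.unusedSectionVars false

/-- The edge `e` has one endpoint in `X` and one outside `X`. -/
def CrossesE (X : Set V) (e : Sym2 V) : Prop := ∃ x y : V, e = s(x, y) ∧ x ∈ X ∧ y ∉ X

theorem degE_insert {F : Finset (Sym2 V)} {e : Sym2 V} (he : e ∉ F) (v : V) :
    degE (insert e F) v = degE F v + if v ∈ e then 1 else 0 := by
  unfold degE
  rw [Finset.filter_insert]
  split_ifs with h
  · rw [Finset.card_insert_of_notMem (by simp [he])]
  · rfl

theorem degE_erase_add {F : Finset (Sym2 V)} {e : Sym2 V} (he : e ∈ F) (v : V) :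
    degE (F.erase e) v + (if v ∈ e then 1 else 0) = degE F v := by
  rw [← degE_insert (Finset.notMem_erase e F) v, Finset.insert_erase he]

theorem degE_mono {F F' : Finset (Sym2 V)} (h : F ⊆ F') (v : V) : degE F v ≤ degE F' v :=
  Finset.card_le_card (Finset.filter_subset_filter _ h)

theorem degE_pos_iff {F : Finset (Sym2 V)} {v : V} : 1 ≤ degE F v ↔ v ∈ VsetE F := by
  simp [degE, VsetE, Finset.one_le_card, Finset.filter_nonempty_iff]

theorem two_le_degE {F : Finset (Sym2 V)} {v : V} {e₁ e₂ : Sym2 V} (h₁ : e₁ ∈ F) (h₂ : e₂ ∈ F)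
    (hne : e₁ ≠ e₂) (hv₁ : v ∈ e₁) (hv₂ : v ∈ e₂) : 2 ≤ degE F v :=
  Finset.one_lt_card.2 ⟨e₁, by simp [*], e₂, by simp [*], hne⟩

/-! ### Cycles -/

theorem IsCycleE.exists_crosses {C : Finset (Sym2 V)} (hC : IsCycleE C) {X : Set V} {v w : V}
    (hv : v ∈ VsetE C) (hw : w ∈ VsetE C) (hvX : v ∈ X) (hwX : w ∉ X) :
    ∃ e₁ ∈ C, ∃ e₂ ∈ C, e₁ ≠ e₂ ∧ CrossesE X e₁ ∧ CrossesE X e₂ := by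
  obtain ⟨m, hm, f, hf, rfl⟩ := hC
  have hm0 : 0 < m := by omega
  have vert : ∀ u ∈ VsetE ((Finset.range m).image fun i => s(f i, f ((i + 1) % m))),
      ∃ i, i < m ∧ f (i % m) = u := by
    rintro u ⟨e, he, hu⟩
    simp only [Finset.mem_image, Finset.mem_range] at he
    obtain ⟨i, hi, rfl⟩ := he
    rcases Sym2.mem_iff.1 hu with rfl | rfl
    · exact ⟨i, hi, by rw [Nat.mod_eq_of_lt hi]⟩
    · exact ⟨(i + 1) % m, Nat.mod_lt _ hm0, by rw [Nat.mod_mod]⟩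
  obtain ⟨i₀, hi₀, rfl⟩ := vert v hv
  obtain ⟨j₀, hj₀, rfl⟩ := vert w hw
  have edge : ∀ n, s(f (n % m), f ((n + 1) % m)) ∈
      (Finset.range m).image fun i => s(f i, f ((i + 1) % m)) := fun n =>
    Finset.mem_image.2 ⟨n % m, Finset.mem_range.2 (Nat.mod_lt _ hm0), by simp⟩
  have leave : ∀ Y : Set V, ∀ i j, j < m → f (i % m) ∈ Y → f (j % m) ∉ Y →
      ∃ n, f (n % m) ∈ Y ∧ f ((n + 1) % m) ∉ Y := by
    intro Y i j hj hi hjY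
    by_contra! h
    have key : ∀ k, f ((i + k) % m) ∈ Y := by
      intro k
      induction k with
      | zero => exact hi
      | succ k ih => exact h _ ih
    apply hjY
    have hle : i ≤ j + m * i := by nlinarith
    have := key (j + m * i - i)
    rwa [Nat.add_sub_cancel' hle, Nat.add_mul_mod_self_left] at this
  obtain ⟨a, haX, haX'⟩ := leave X i₀ j₀ hj₀ hvX hwX
  obtain ⟨b, hbX, hbX'⟩ := leave Xᶜ j₀ i₀ hi₀ hwX (by simpa using hvX)
  rw [Set.notMem_compl_iff] at hbX'
  refine ⟨_, edge a, _, edge b, ?_, ⟨_, _, rfl, haX, haX'⟩, ⟨_, _, Sym2.eq_swap, hbX', hbX⟩⟩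
  intro h
  rcases Sym2.eq_iff.1 h with ⟨h₁, -⟩ | ⟨h₁, h₂⟩
  · exact hbX (h₁ ▸ haX)
  · have e₁ := hf _ (Nat.mod_lt _ hm0) _ (Nat.mod_lt _ hm0) h₁
    have e₂ := hf _ (Nat.mod_lt _ hm0) _ (Nat.mod_lt _ hm0) h₂
    have e₃ : a + 2 ≡ a + 0 [MOD m] := by
      have : a + 1 + 1 ≡ b + 1 [MOD m] := Nat.ModEq.add_right 1 e₂
      exact this.trans (Nat.ModEq.symm e₁)
    have := Nat.ModEq.add_left_cancel' a e₃
    rw [Nat.ModEq, Nat.mod_eq_of_lt (by omega : 2 < m), Nat.zero_mod] at this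
    omega

theorem IsCycleE.exists_three {C : Finset (Sym2 V)} (hC : IsCycleE C) :
    ∃ x ∈ VsetE C, ∃ y ∈ VsetE C, ∃ z ∈ VsetE C, x ≠ y ∧ x ≠ z ∧ y ≠ z := by
  obtain ⟨m, hm, f, hf, rfl⟩ := hC
  have vert : ∀ i < m, f i ∈ VsetE ((Finset.range m).image fun i => s(f i, f ((i + 1) % m))) :=
    fun i hi => ⟨_, Finset.mem_image.2 ⟨i, Finset.mem_range.2 hi, rfl⟩, Sym2.mem_mk_left _ _⟩
  refine ⟨f 0, vert 0 (by omega), f 1, vert 1 (by omega), f 2, vert 2 (by omega), ?_, ?_, ?_⟩ <;>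
  · intro h
    have := hf _ (by omega) _ (by omega) h
    omega

theorem IsCycleE.two_le_degE {C : Finset (Sym2 V)} (hC : IsCycleE C) {v : V} (hv : v ∈ VsetE C) :
    2 ≤ degE C v := by
  obtain ⟨w, hw, hwv⟩ : ∃ w ∈ VsetE C, w ∉ ({v} : Set V) := by
    obtain ⟨x, hx, y, hy, -, -, hxy, -⟩ := hC.exists_three
    by_cases h : x = v
    · exact ⟨y, hy, fun h' => hxy (h.trans h'.symm)⟩
    · exact ⟨x, hx, h⟩
  obtain ⟨e₁, h₁, e₂, h₂, hne, ⟨x₁, y₁, rfl, rfl, -⟩, ⟨x₂, y₂, rfl, rfl, -⟩⟩ :=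
    hC.exists_crosses hv hw (Set.mem_singleton v) hwv
  exact _root_.two_le_degE h₁ h₂ hne (Sym2.mem_mk_left _ _) (Sym2.mem_mk_left _ _)

/-! ### Paths -/

namespace IsPathE

variable {P : Finset (Sym2 V)} {a b : V}

theorem symm (h : IsPathE P a b) : IsPathE P b a := by
  obtain ⟨m, hm, f, hf, rfl, rfl, rfl⟩ := h
  refine ⟨m, hm, fun i => f (m - i), fun i hi j hj hij => ?_, by simp, by simp, ?_⟩
  · have := hf _ (by omega) _ (by omega) hij
    omega
  · ext e
    simp only [Finset.mem_image, Finset.mem_range]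
    constructor
    · rintro ⟨i, hi, rfl⟩
      refine ⟨m - 1 - i, by omega, ?_⟩
      rw [Sym2.eq_swap, show m - (m - 1 - i + 1) = i by omega,
        show m - (m - 1 - i) = i + 1 by omega]
    · rintro ⟨i, hi, rfl⟩
      refine ⟨m - 1 - i, by omega, ?_⟩
      rw [Sym2.eq_swap, show m - (i + 1) = m - 1 - i by omega,
        show m - i = m - 1 - i + 1 by omega]

theorem ne (h : IsPathE P a b) : a ≠ b := by
  obtain ⟨m, hm, f, hf, rfl, rfl, rfl⟩ := h
  intro h
  have := hf _ (by omega) _ (by omega) h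
  omega

theorem right_mem (h : IsPathE P a b) : b ∈ VsetE P := by
  obtain ⟨m, hm, f, hf, rfl, rfl, rfl⟩ := h
  refine ⟨_, Finset.mem_image.2 ⟨m - 1, Finset.mem_range.2 (by omega), rfl⟩, ?_⟩
  rw [Nat.sub_add_cancel hm]
  exact Sym2.mem_mk_right _ _

theorem snoc (h : IsPathE P a b) {y : V} (hy : y ∉ VsetE P) :
    IsPathE (insert s(b, y) P) a y := by
  obtain ⟨m, hm, f, hf, rfl, rfl, rfl⟩ := h
  have hfy : ∀ i ≤ m, f i ≠ y := by
    rintro i hi rfl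
    apply hy
    rcases Nat.lt_or_ge i m with h | h
    · exact ⟨_, Finset.mem_image.2 ⟨i, Finset.mem_range.2 h, rfl⟩, Sym2.mem_mk_left _ _⟩
    · obtain rfl : i = m := le_antisymm hi h
      exact right_mem ⟨i, hm, f, hf, rfl, rfl, rfl⟩
  refine ⟨m + 1, by omega, fun i => if i ≤ m then f i else y, fun i hi j hj hij => ?_,
    by simp, by simp, ?_⟩
  · dsimp only at hij
    split_ifs at hij with h₁ h₂ h₂
    · exact hf i h₁ j h₂ hij
    · exact absurd hij (hfy i h₁)
    · exact absurd hij.symm (hfy j h₂)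
    · omega
  · rw [Finset.range_add_one, Finset.image_insert]
    congr 1
    · simp
    · refine Finset.image_congr fun i hi => ?_
      have : i < m := by simpa using hi
      simp [this.le, Nat.succ_le_of_lt this]

theorem exists_index (m : ℕ) (f : ℕ → V) {v : V}
    (hv : v ∈ VsetE ((Finset.range m).image fun i => s(f i, f (i + 1)))) : ∃ i ≤ m, f i = v := by
  obtain ⟨e, he, hv⟩ := hv
  simp only [Finset.mem_image, Finset.mem_range] at he
  obtain ⟨i, hi, rfl⟩ := he
  rcases Sym2.mem_iff.1 hv with rfl | rfl
  · exact ⟨i, hi.le, rfl⟩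
  · exact ⟨i + 1, hi, rfl⟩

theorem two_le_degE (h : IsPathE P a b) {v : V} (hv : v ∈ VsetE P) (hva : v ≠ a) (hvb : v ≠ b) :
    2 ≤ degE P v := by
  obtain ⟨m, hm, f, hf, rfl, rfl, rfl⟩ := h
  obtain ⟨i, hi, rfl⟩ := exists_index m f hv
  have hi0 : i ≠ 0 := by rintro rfl; exact hva rfl
  have him : i ≠ m := by rintro rfl; exact hvb rfl
  refine _root_.two_le_degE (e₁ := s(f (i - 1), f (i - 1 + 1))) (e₂ := s(f i, f (i + 1)))
    (Finset.mem_image.2 ⟨i - 1, by simp; omega, rfl⟩)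
    (Finset.mem_image.2 ⟨i, by simp; omega, rfl⟩) ?_ ?_ (Sym2.mem_mk_left _ _)
  · intro h
    rw [Sym2.eq_iff] at h
    rcases h with ⟨h, -⟩ | ⟨h, -⟩ <;>
    · have := hf _ (by omega) _ (by omega) h
      omega
  · rw [Nat.sub_add_cancel (by omega)]
    exact Sym2.mem_mk_right _ _

/-- A set containing an inner vertex of a path, together with all path neighbours of its inner
vertices, contains the whole path. -/
theorem vsetE_subset (h : IsPathE P a b) {X : Set V}
    (hX : ∀ v ∈ X, v ≠ a → v ≠ b → ∀ w, s(v, w) ∈ P → w ∈ X)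
    {z : V} (hz : z ∈ VsetE P) (hzX : z ∈ X) (hza : z ≠ a) (hzb : z ≠ b) : VsetE P ⊆ X := by
  obtain ⟨m, hm, f, hf, rfl, rfl, rfl⟩ := h
  obtain ⟨i, hi, rfl⟩ := exists_index m f hz
  have hi0 : i ≠ 0 := by rintro rfl; exact hza rfl
  have him : i ≠ m := by rintro rfl; exact hzb rfl
  have step : ∀ j, 0 < j → j < m → f j ∈ X → f (j + 1) ∈ X ∧ f (j - 1) ∈ X := by
    intro j hj0 hjm hj
    have h0 : f j ≠ f 0 := fun h => by have := hf _ hjm.le _ (by omega) h; omega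
    have h1 : f j ≠ f m := fun h => by have := hf _ hjm.le _ le_rfl h; omega
    refine ⟨hX _ hj h0 h1 _ (Finset.mem_image.2 ⟨j, by simpa using hjm, rfl⟩),
      hX _ hj h0 h1 _ (Finset.mem_image.2 ⟨j - 1, by simp; omega, ?_⟩)⟩
    rw [Nat.sub_add_cancel hj0, Sym2.eq_swap]
  have up : ∀ k, i + k ≤ m → f (i + k) ∈ X := by
    intro k
    induction k with
    | zero => exact fun _ => hzX
    | succ k ih => exact fun hk => (step (i + k) (by omega) (by omega) (ih (by omega))).1
  have down : ∀ k, k ≤ i → f (i - k) ∈ X := by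
    intro k
    induction k with
    | zero => exact fun _ => hzX
    | succ k ih => exact fun hk => (step (i - k) (by omega) (by omega) (ih (by omega))).2
  intro v hv
  obtain ⟨j, hj, rfl⟩ := exists_index m f hv
  rcases le_total i j with h | h
  · have := up (j - i) (by omega)
    rwa [Nat.add_sub_cancel' h] at this
  · have := down (i - j) (by omega)
    rwa [Nat.sub_sub_self h] at this

theorem isCycleE_insert (h : IsPathE P a b) (he : s(b, a) ∉ P) :
    IsCycleE (insert s(b, a) P) := by
  obtain ⟨m, hm, f, hf, rfl, rfl, rfl⟩ := h
  have hm2 : m ≠ 1 := by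
    rintro rfl
    exact he (Finset.mem_image.2 ⟨0, by simp, Sym2.eq_swap⟩)
  refine ⟨m + 1, by omega, f, fun i hi j hj => hf i (by omega) j (by omega), ?_⟩
  rw [Finset.range_add_one, Finset.image_insert, Nat.mod_self]
  congr 1
  refine Finset.image_congr fun i hi => ?_
  have : i < m := by simpa using hi
  rw [Nat.mod_eq_of_lt (by omega)]

theorem of_edge {x y : V} (h : x ≠ y) : IsPathE {s(x, y)} x y := by
  refine ⟨1, le_rfl, fun i => if i = 0 then x else y, fun i hi j hj hij => ?_, by simp, by simp,
    by simp⟩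
  dsimp only at hij
  split_ifs at hij
  · omega
  · exact absurd hij h
  · exact absurd hij.symm h
  · omega

/-- A vertex of a path in a 2-matching `F` incident to a further edge of `F` is an end. -/
theorem eq_or_eq_of_mem {F : Finset (Sym2 V)} (h : IsPathE P a b) (hPF : P ⊆ F) {v : V}
    {e : Sym2 V} (hF : degE F v ≤ 2) (hv : v ∈ VsetE P) (he : e ∈ F) (heP : e ∉ P) (hve : v ∈ e) :
    v = a ∨ v = b := by
  by_contra! hne
  have h₁ := h.two_le_degE hv hne.1 hne.2
  have h₂ := degE_mono (Finset.insert_subset he hPF) v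
  rw [degE_insert heP, if_pos hve] at h₂
  omega

end IsPathE

/-- Every non-isolated vertex of an acyclic 2-matching lies on a maximal path. -/
theorem exists_maxPathE {T : Finset (Sym2 V)} (hT : IsKMatching 2 T) (hac : AcyclicE T) {v : V}
    (hv : v ∈ VsetE T) : ∃ P, MaxPathE T P ∧ v ∈ VsetE P := by
  classical
  obtain ⟨P, hP, hmax⟩ := Finset.exists_max_image
    (T.powerset.filter fun P => (∃ a b, IsPathE P a b) ∧ v ∈ VsetE P) Finset.card (by
      obtain ⟨e, he, hve⟩ := hv
      refine ⟨{e}, ?_⟩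
      simp only [Finset.mem_filter, Finset.mem_powerset, Finset.singleton_subset_iff]
      refine ⟨he, ?_, ⟨e, by simp, hve⟩⟩
      induction e with
      | h x y => exact ⟨x, y, IsPathE.of_edge fun h => hT.1 _ he (by simpa using h)⟩)
  simp only [Finset.mem_filter, Finset.mem_powerset] at hP hmax
  obtain ⟨hPT, hpath, hvP⟩ := hP
  refine ⟨P, ⟨hPT, hpath, ?_⟩, hvP⟩
  rintro e he ⟨u, hue, huP⟩
  by_contra heP
  obtain ⟨a, b, hab, rfl⟩ : ∃ a b, IsPathE P a b ∧ u = b := by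
    obtain ⟨a, b, hab⟩ := hpath
    rcases hab.eq_or_eq_of_mem hPT (hT.2 u) huP he heP hue with rfl | rfl
    · exact ⟨_, _, hab.symm, rfl⟩
    · exact ⟨_, _, hab, rfl⟩
  obtain ⟨w, rfl⟩ := Sym2.mem_iff_exists.1 hue
  by_cases hw : w ∈ VsetE P
  · rcases hab.eq_or_eq_of_mem hPT (hT.2 w) hw he heP (Sym2.mem_mk_right _ _) with rfl | rfl
    · exact hac _ (Finset.insert_subset he hPT) (hab.isCycleE_insert heP)
    · exact hT.1 _ he (by simp)
  · have := hmax _ ⟨Finset.insert_subset he hPT, ⟨_, _, hab.snoc hw⟩, by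
      obtain ⟨e, he, hve⟩ := hvP
      exact ⟨e, Finset.mem_insert_of_mem he, hve⟩⟩
    rw [Finset.card_insert_of_notMem heP] at this
    omega

theorem MaxPathE.not_crossesE {T P : Finset (Sym2 V)} (hP : MaxPathE T P) {e : Sym2 V}
    (he : e ∈ T) : ¬ CrossesE (VsetE P) e := by
  rintro ⟨x, y, rfl, hx, hy⟩
  exact hy ⟨_, hP.2.2 _ he ⟨x, Sym2.mem_mk_left _ _, hx⟩, Sym2.mem_mk_right _ _⟩

theorem MaxPathE.acyclicE_insert {T P : Finset (Sym2 V)} (hP : MaxPathE T P) (hT : AcyclicE T)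
    {e : Sym2 V} (he : CrossesE (VsetE P) e) : AcyclicE (insert e T) := by
  intro D hDT hD
  by_cases heD : e ∈ D
  · obtain ⟨x, y, rfl, hx, hy⟩ := he
    obtain ⟨e₁, h₁, e₂, h₂, hne, hc₁, hc₂⟩ := hD.exists_crosses
      ⟨_, heD, Sym2.mem_mk_left _ _⟩ ⟨_, heD, Sym2.mem_mk_right _ _⟩ hx hy
    rcases Finset.mem_insert.1 (hDT h₁) with h₁ | h₁
    · rcases Finset.mem_insert.1 (hDT h₂) with h₂ | h₂
      · exact hne (h₁.trans h₂.symm)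
      · exact hP.not_crossesE h₂ hc₂
    · exact hP.not_crossesE h₁ hc₁
  · exact hT D ((Finset.subset_insert_iff_of_notMem heD).1 hDT) hD

/-! ### Valid pairs -/

section Exchange

variable {S T C : Finset (Sym2 V)} {e : Sym2 V}

theorem ValidPairE.degE_eq_of_mem_cycle (h : ValidPairE S T) (hCS : C ⊆ S) (hC : IsCycleE C)
    {v : V} (hv : v ∈ VsetE C) : degE S v = 2 :=
  le_antisymm (h.1.2 v) ((hC.two_le_degE hv).trans (degE_mono hCS v))

theorem ValidPairE.one_le_degE_right (h : ValidPairE S T) (v : V) : 1 ≤ degE T v :=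
  degE_pos_iff.2 (h.2.2.2.1 ▸ Set.mem_univ v)

theorem ValidPairE.degE_right_eq_one (h : ValidPairE S T) (heS : e ∈ S) (heT : e ∉ T) {v : V}
    (hve : v ∈ e) (hv : degE S v = 2) : degE T v = 1 := by
  have h₁ := h.one_le_degE_right v
  have h₂ := h.2.1.2 v
  by_contra h₃
  have h₄ : e ∈ deltaE S v := by simp [deltaE, heS, hve]
  rw [h.2.2.2.2.2.1 v hv (show degE T v = 2 by omega)] at h₄
  exact heT (Finset.mem_filter.1 h₄).1

theorem ValidPairE.exchange (h : ValidPairE S T) (heS : e ∈ S) (heT : e ∉ T)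
    (hdeg : ∀ v ∈ e, degE S v = 2) (hac : AcyclicE (insert e T)) :
    ValidPairE (S.erase e) (insert e T) := by
  have hdegT : ∀ v ∈ e, degE T v = 1 := fun v hv => h.degE_right_eq_one heS heT hv (hdeg v hv)
  have hins := degE_insert heT
  have hera := degE_erase_add heS
  obtain ⟨⟨hS, hS2⟩, ⟨hT, hT2⟩, hSs, hTs, -, hδ, hVC⟩ := h
  have hera_le : ∀ v ∈ e, degE (S.erase e) v = 1 := fun v hv => by
    have := hera v
    rw [if_pos hv, hdeg v hv] at this
    omega
  refine ⟨⟨fun f hf => hS f (Finset.mem_of_mem_erase hf),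
      fun v => (degE_mono (Finset.erase_subset _ _) v).trans (hS2 v)⟩,
    ⟨?_, fun v => ?_⟩, ?_, ?_, hac, ?_, ?_⟩
  · intro f hf
    rcases Finset.mem_insert.1 hf with rfl | hf
    · exact hS f heS
    · exact hT f hf
  · rw [hins]
    split_ifs with hv
    · rw [hdegT v hv]
    · exact hT2 v
  · refine Set.eq_univ_of_forall fun v => degE_pos_iff.1 ?_
    by_cases hv : v ∈ e
    · exact (hera_le v hv).ge
    · have := hera v
      rw [if_neg hv, add_zero] at this
      rw [this]
      exact degE_pos_iff.2 (hSs ▸ Set.mem_univ v)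
  · exact Set.eq_univ_of_forall fun v => degE_pos_iff.1
      ((degE_pos_iff.2 (hTs ▸ Set.mem_univ v)).trans (degE_mono (Finset.subset_insert e T) v))
  · intro v hvS hvT
    change degE _ _ = 2 at hvS hvT
    by_cases hv : v ∈ e
    · have := hera_le v hv
      omega
    · have h₁ := hera v
      have h₂ := hins v
      rw [if_neg hv, add_zero] at h₁ h₂
      have := hδ v (h₁.symm.trans hvS) (h₂.symm.trans hvT)
      unfold deltaE at this ⊢
      rw [Finset.filter_insert, if_neg hv, ← this, Finset.filter_erase,
        Finset.erase_eq_of_notMem (by simp [hv])]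
  · intro D hDS hD P hP hVDP
    by_cases heP : e ∈ P
    · induction e with
      | h x y =>
        have hx : x ∈ VsetE D := hVDP ▸ ⟨_, heP, Sym2.mem_mk_left _ _⟩
        have h₁ := (hD.two_le_degE hx).trans (degE_mono hDS x)
        have := hera_le x (Sym2.mem_mk_left _ _)
        omega
    · refine hVC D (hDS.trans (Finset.erase_subset _ _)) hD P ⟨?_, hP.2.1, fun f hf =>
        hP.2.2 f (Finset.mem_insert_of_mem hf)⟩ hVDP
      exact (Finset.subset_insert_iff_of_notMem heP).1 hP.1

theorem ValidPairE.V1E_exchange (h : ValidPairE S T) (heS : e ∈ S) (heT : e ∉ T)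
    (hdeg : ∀ v ∈ e, degE S v = 2) :
    V1E (S.erase e) ∪ V1E (insert e T) = V1E S ∪ V1E T ∧
      V1E (S.erase e) ∩ V1E (insert e T) = V1E S ∩ V1E T := by
  have key : ∀ v, (degE (S.erase e) v = 1 ∨ degE (insert e T) v = 1 ↔
      degE S v = 1 ∨ degE T v = 1) ∧ (degE (S.erase e) v = 1 ∧ degE (insert e T) v = 1 ↔
      degE S v = 1 ∧ degE T v = 1) := by
    intro v
    have h₁ := degE_insert heT v
    have h₂ := degE_erase_add heS v
    by_cases hv : v ∈ e
    · have h₃ := hdeg v hv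
      have h₄ := h.degE_right_eq_one heS heT hv h₃
      rw [if_pos hv] at h₁ h₂
      omega
    · rw [if_neg hv] at h₁ h₂
      omega
  exact ⟨Set.ext fun v => (key v).1, Set.ext fun v => (key v).2⟩

theorem ValidPairE.exists_notMem_maxPathE (h : ValidPairE S T) (hCS : C ⊆ S) (hC : IsCycleE C)
    {P : Finset (Sym2 V)} (hP : MaxPathE T P) : ∃ w ∈ VsetE C, w ∉ VsetE P := by
  by_contra! hsub
  refine h.2.2.2.2.2.2 C hCS hC P hP (Set.Subset.antisymm hsub ?_)
  obtain ⟨a, b, hab⟩ := hP.2.1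
  obtain ⟨z, hz, hza, hzb⟩ : ∃ z ∈ VsetE C, z ≠ a ∧ z ≠ b := by
    obtain ⟨x, hx, y, hy, z, hz, hxy, hxz, hyz⟩ := hC.exists_three
    by_contra! hall
    have hall' : ∀ u ∈ VsetE C, u = a ∨ u = b := fun u hu => or_iff_not_imp_left.2 (hall u hu)
    rcases hall' x hx with rfl | rfl <;> rcases hall' y hy with rfl | rfl <;>
      rcases hall' z hz with rfl | rfl <;> contradiction
  refine hab.vsetE_subset (fun v hvC hva hvb w hvw => ?_) (hsub z hz) hz hza hzb
  by_cases hvwC : s(v, w) ∈ C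
  · exact ⟨_, hvwC, Sym2.mem_mk_right _ _⟩
  · have hS2 := h.degE_eq_of_mem_cycle hCS hC hvC
    have hT2 : degE T v = 2 := le_antisymm (h.2.1.2 v)
      ((hab.two_le_degE (hsub v hvC) hva hvb).trans (degE_mono hP.1 v))
    have hmem : s(v, w) ∈ deltaE S v := by
      rw [h.2.2.2.2.2.1 v hS2 hT2]
      simp [deltaE, hP.1 hvw]
    have h₁ := degE_mono (Finset.insert_subset (Finset.mem_filter.1 hmem).1 hCS) v
    rw [degE_insert hvwC, if_pos (Sym2.mem_mk_left _ _)] at h₁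
    have h₂ := hC.two_le_degE hvC
    omega

theorem ValidPairE.isPathE_insert (h : ValidPairE S T) {P : Finset (Sym2 V)} (hP : MaxPathE T P)
    (heS : e ∈ S) (hdeg : ∀ v ∈ e, degE S v = 2) (he : CrossesE (VsetE P) e) :
    ∃ a b, IsPathE (insert e P) a b := by
  have heT : e ∉ T := fun heT => hP.not_crossesE heT he
  obtain ⟨x, y, rfl, hx, hy⟩ := he
  have hxe : x ∈ s(x, y) := Sym2.mem_mk_left _ _
  have hT := h.degE_right_eq_one heS heT hxe (hdeg x hxe)
  obtain ⟨a, b, hab⟩ := hP.2.1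
  by_cases hxb : x = b
  · subst hxb
    exact ⟨_, _, hab.snoc hy⟩
  by_cases hxa : x = a
  · subst hxa
    exact ⟨_, _, hab.symm.snoc hy⟩
  have := (hab.two_le_degE hx hxa hxb).trans (degE_mono hP.1 x)
  omega

end Exchange

/-- Lemma 2 of the paper. -/
theorem stmt0 (S T C : Finset (Sym2 V))
    (hST : ValidPairE S T) (hCS : C ⊆ S) (hC : IsCycleE C) :
    ∃ e1 ∈ C, ∃ e2 ∈ C, e1 ≠ e2 ∧
      -- (a) both modified pairs are valid
      ValidPairE (S.erase e1) (insert e1 T) ∧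
      ValidPairE (S.erase e2) (insert e2 T) ∧
      -- (b) the V1-union and V1-intersection are preserved
      (V1E (S.erase e1) ∪ V1E (insert e1 T) = V1E S ∪ V1E T) ∧
      (V1E (S.erase e1) ∩ V1E (insert e1 T) = V1E S ∩ V1E T) ∧
      (V1E (S.erase e2) ∪ V1E (insert e2 T) = V1E S ∪ V1E T) ∧
      (V1E (S.erase e2) ∩ V1E (insert e2 T) = V1E S ∩ V1E T) ∧
      -- (c) some maximal path of T extends by either edge to a path
      (∃ P : Finset (Sym2 V), MaxPathE T P ∧
        (∃ a b : V, IsPathE (insert e1 P) a b) ∧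
        (∃ a b : V, IsPathE (insert e2 P) a b)) := by
  obtain ⟨v, hv, -⟩ := hC.exists_three
  have hvT : v ∈ VsetE T := degE_pos_iff.1 (hST.one_le_degE_right v)
  obtain ⟨P, hP, hvP⟩ := exists_maxPathE hST.2.1 hST.2.2.2.2.1 hvT
  obtain ⟨w, hw, hwP⟩ := hST.exists_notMem_maxPathE hCS hC hP
  obtain ⟨e₁, h₁, e₂, h₂, hne, hc₁, hc₂⟩ := hC.exists_crosses hv hw hvP hwP
  have hdeg : ∀ e ∈ C, ∀ u ∈ e, degE S u = 2 := fun e he u hu =>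
    hST.degE_eq_of_mem_cycle hCS hC ⟨e, he, hu⟩
  have hnot : ∀ e, CrossesE (VsetE P) e → e ∉ T := fun e hc he => hP.not_crossesE he hc
  have hvalid : ∀ e ∈ C, CrossesE (VsetE P) e → ValidPairE (S.erase e) (insert e T) :=
    fun e he hc => hST.exchange (hCS he) (hnot e hc) (hdeg e he)
      (hP.acyclicE_insert hST.2.2.2.2.1 hc)
  have hV1₁ := hST.V1E_exchange (hCS h₁) (hnot e₁ hc₁) (hdeg e₁ h₁)
  have hV1₂ := hST.V1E_exchange (hCS h₂) (hnot e₂ hc₂) (hdeg e₂ h₂)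
  exact ⟨e₁, h₁, e₂, h₂, hne, hvalid e₁ h₁ hc₁, hvalid e₂ h₂ hc₂, hV1₁.1, hV1₁.2, hV1₂.1, hV1₂.2,
    P, hP, hST.isPathE_insert hP (hCS h₁) (hdeg e₁ h₁) hc₁,
    hST.isPathE_insert hP (hCS h₂) (hdeg e₂ h₂) hc₂⟩
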